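/- Let G = PSL(2,ℤ) with r, u, S = {r, u, u⁻¹} as above. For every g ∈ G and every s ∈ S, one has |g·s| = |g| + 1 or |g·s| = |g| − 1 (never |g·s| = |g|), and moreover |g·s| = |g| + 1 if and only if the one-letter word s⁻¹ does not belong to 𝐒₁(g). -/

import Mathlib

namespace PSL2Z

abbrev SL2Z : Type := Matrix.SpecialLinearGroup (Fin 2) ℤ

/-- `PSL(2,ℤ)`: the quotient of `SL(2,ℤ)` by its center `{±I}`. -/
abbrev G : Type := SL2Z ⧸ Subgroup.center SL2Z

/-- The image in `PSL(2,ℤ)` of the matrix `[[0,1],[-1,0]]`. -/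
def r : G := QuotientGroup.mk (⟨!![0, 1; -1, 0], by norm_num [Matrix.det_fin_two_of]⟩ : SL2Z)

/-- The image in `PSL(2,ℤ)` of the matrix `[[1,1],[0,1]]`. -/
def u : G := QuotientGroup.mk (⟨!![1, 1; 0, 1], by norm_num [Matrix.det_fin_two_of]⟩ : SL2Z)

/-- The symmetric generating set `S = {r, u, u⁻¹}`. -/
def S : Set G := {r, u, u⁻¹}

/-- A word in `S`: a finite list of elements of `S`. -/
def IsWord (w : List G) : Prop := ∀ x ∈ w, x ∈ S

/-- The word norm `|g|`: the least length of a word in `S` representing `g`. -/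
noncomputable def wordNorm (g : G) : ℕ :=
  sInf {n | ∃ w : List G, IsWord w ∧ w.prod = g ∧ w.length = n}

/-- A geodesic for `g`: a word in `S` representing `g` of length `|g|`. -/
def IsGeodesic (g : G) (w : List G) : Prop :=
  IsWord w ∧ w.prod = g ∧ w.length = wordNorm g

/-- `𝐒ₙ(g)`: the set of suffixes of length `n` of geodesics for `g`. -/
def Suf (n : ℕ) (g : G) : Set (List G) :=
  {v | v.length = n ∧ ∃ w : List G, IsGeodesic g w ∧ v <:+ w}

open Classical in
/-- `𝐒₂*(g)`: `𝐒₂(g)` if nonempty, otherwise `𝐒₁(g)` (which is `∅` exactly when `g = 1`). -/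
noncomputable def Suf2Star (g : G) : Set (List G) :=
  if (Suf 2 g).Nonempty then Suf 2 g else Suf 1 g

/-- `S⁺(g) = {s ∈ S : |g·s| = |g| + 1}`. -/
def Splus (g : G) : Set G := {s ∈ S | wordNorm (g * s) = wordNorm g + 1}

/-- The character of `SL(2,ℤ)` given by the sign of the image in `SL(2,𝔽₂) ≅ S₃`. -/
def signSL : SL2Z →* Multiplicative (ZMod 2) where
  toFun A := Multiplicative.ofAdd
    ((A 0 0 * A 0 1 + A 0 1 * A 1 0 + A 1 0 * A 1 1 : ℤ) : ZMod 2)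
  map_one' := by simp
  map_mul' A B := by
    have key : ∀ a b c d a' b' c' d' : ZMod 2, a * d - b * c = 1 → a' * d' - b' * c' = 1 →
        (a * a' + b * c') * (a * b' + b * d') + (a * b' + b * d') * (c * a' + d * c') +
          (c * a' + d * c') * (c * b' + d * d') =
        (a * b + b * c + c * d) + (a' * b' + b' * c' + c' * d') := by decide
    have hdet (C : SL2Z) : (C 0 0 : ZMod 2) * C 1 1 - C 0 1 * C 1 0 = 1 := by
      exact_mod_cast congrArg (Int.cast : ℤ → ZMod 2) ((Matrix.det_fin_two C.1).symm.trans C.2)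
    rw [← ofAdd_add]
    congr 1
    simpa [Matrix.mul_apply, Fin.sum_univ_two] using key _ _ _ _ _ _ _ _ (hdet A) (hdet B)

/-- The character of `PSL(2,ℤ)` induced by `signSL`. -/
def sign : G →* Multiplicative (ZMod 2) :=
  QuotientGroup.lift _ signSL fun A hA => by
    obtain ⟨c, -, hc⟩ := Matrix.SpecialLinearGroup.mem_center_iff.1 hA
    have h01 : A.1 0 1 = 0 := by rw [← hc, Matrix.scalar_apply]; simp
    have h10 : A.1 1 0 = 0 := by rw [← hc, Matrix.scalar_apply]; simp
    simp [signSL, h01, h10]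

theorem sign_r : sign r = Multiplicative.ofAdd 1 := by
  change signSL _ = _
  simp [signSL]

theorem sign_u : sign u = Multiplicative.ofAdd 1 := by
  change signSL _ = _
  simp [signSL]

theorem sign_of_mem_S {s : G} (hs : s ∈ S) : sign s = Multiplicative.ofAdd 1 := by
  rcases hs with rfl | rfl | rfl
  · exact sign_r
  · exact sign_u
  · rw [map_inv, sign_u]; rfl

theorem sign_prod {w : List G} (hw : IsWord w) :
    sign w.prod = Multiplicative.ofAdd (w.length : ZMod 2) := by
  induction w with
  | nil => simp
  | cons a w ih =>
    rw [List.prod_cons, map_mul, sign_of_mem_S (hw a (by simp)),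
      ih fun x hx => hw x (by simp [hx]), ← ofAdd_add, List.length_cons]
    push_cast
    rw [add_comm]

theorem mk_S : (QuotientGroup.mk ModularGroup.S : G) = r := by
  refine QuotientGroup.eq.2 (Matrix.SpecialLinearGroup.mem_center_iff.2 ⟨-1, by simp, ?_⟩)
  ext i j
  fin_cases i <;> fin_cases j <;> rfl

theorem r_inv : r⁻¹ = r := by
  refine inv_eq_of_mul_eq_one_left ((QuotientGroup.eq_one_iff _).2
    (Matrix.SpecialLinearGroup.mem_center_iff.2 ⟨-1, by simp, ?_⟩))
  ext i j
  fin_cases i <;> fin_cases j <;> rfl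

theorem inv_mem_S {s : G} (hs : s ∈ S) : s⁻¹ ∈ S := by
  rcases hs with rfl | rfl | rfl
  · simp [r_inv, S]
  · simp [S]
  · simp [S]

theorem closure_r_u : Subgroup.closure {r, u} = ⊤ := by
  have h := congrArg (Subgroup.map (QuotientGroup.mk' (Subgroup.center SL2Z)))
    SpecialLinearGroup.SL2Z_generators
  have hr : QuotientGroup.mk' (Subgroup.center SL2Z) ModularGroup.S = r := mk_S
  have hu : QuotientGroup.mk' (Subgroup.center SL2Z) ModularGroup.T = u := rfl
  rwa [MonoidHom.map_closure, Set.image_pair, hr, hu,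
    Subgroup.map_top_of_surjective _ (QuotientGroup.mk'_surjective _)] at h

theorem IsWord.append {v w : List G} (hv : IsWord v) (hw : IsWord w) : IsWord (v ++ w) :=
  fun x hx => (List.mem_append.1 hx).elim (hv x) (hw x)

theorem isWord_singleton {s : G} (hs : s ∈ S) : IsWord [s] := by simpa [IsWord] using hs

theorem exists_word (g : G) : ∃ w : List G, IsWord w ∧ w.prod = g := by
  have hg : g ∈ (Subgroup.closure {r, u}).toSubmonoid := by simp [closure_r_u]
  rw [Subgroup.closure_toSubmonoid] at hg
  obtain ⟨w, hw, hprod⟩ := Submonoid.exists_list_of_mem_closure hg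
  refine ⟨w, fun x hx => ?_, hprod⟩
  have hS : ∀ y ∈ ({r, u} : Set G), y ∈ S := by
    rintro y (rfl | rfl) <;> simp [S]
  rcases hw x hx with h | h
  · exact hS x h
  · simpa using inv_mem_S (hS _ h)

theorem exists_isGeodesic (g : G) : ∃ w : List G, IsGeodesic g w := by
  obtain ⟨w, hw, hg⟩ := exists_word g
  exact Nat.sInf_mem (s := {n | ∃ w : List G, IsWord w ∧ w.prod = g ∧ w.length = n})
    ⟨w.length, w, hw, hg, rfl⟩

theorem wordNorm_prod_le {w : List G} (hw : IsWord w) : wordNorm w.prod ≤ w.length :=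
  Nat.sInf_le ⟨w, hw, rfl, rfl⟩

theorem sign_eq_wordNorm (g : G) : sign g = Multiplicative.ofAdd (wordNorm g : ZMod 2) := by
  obtain ⟨w, hw, hg, hl⟩ := exists_isGeodesic g
  rw [← hl, ← sign_prod hw, hg]

theorem wordNorm_mul_le (g : G) {s : G} (hs : s ∈ S) : wordNorm (g * s) ≤ wordNorm g + 1 := by
  obtain ⟨w, hw, hg, hl⟩ := exists_isGeodesic g
  simpa [hg, hl] using wordNorm_prod_le (hw.append (isWord_singleton hs))

theorem wordNorm_le_mul (g : G) {s : G} (hs : s ∈ S) : wordNorm g ≤ wordNorm (g * s) + 1 := by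
  simpa using wordNorm_mul_le (g * s) (inv_mem_S hs)

theorem wordNorm_mul_ne (g : G) {s : G} (hs : s ∈ S) : wordNorm (g * s) ≠ wordNorm g := by
  intro h
  have hsign := sign_eq_wordNorm (g * s)
  rw [map_mul, h, ← sign_eq_wordNorm, sign_of_mem_S hs, mul_eq_left] at hsign
  exact absurd hsign (by decide)

theorem inv_mem_Suf_one_iff (g : G) {s : G} (hs : s ∈ S) :
    [s⁻¹] ∈ Suf 1 g ↔ wordNorm (g * s) + 1 = wordNorm g := by
  constructor
  · rintro ⟨-, _, ⟨hw, hg, hl⟩, v, rfl⟩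
    have hv : wordNorm v.prod ≤ v.length :=
      wordNorm_prod_le fun x hx => hw x (List.mem_append_left _ hx)
    have hgs : v.prod = g * s := by simp [← hg]
    rw [hgs] at hv
    rw [List.length_append, List.length_singleton] at hl
    have := wordNorm_le_mul g hs
    omega
  · intro h
    obtain ⟨w, hw, hg, hl⟩ := exists_isGeodesic (g * s)
    exact ⟨rfl, w ++ [s⁻¹], ⟨hw.append (isWord_singleton (inv_mem_S hs)), by simp [hg],
      by simp [hl, h]⟩, List.suffix_append _ _⟩

/-- In `PSL(2,ℤ)` with `S = {r, u, u⁻¹}`, for every `g` and `s ∈ S` one has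
`|g·s| = |g| + 1` or `|g·s| = |g| − 1`, never `|g·s| = |g|`; moreover
`|g·s| = |g| + 1` iff the one-letter word `s⁻¹` is not a suffix of a geodesic for `g`. -/
theorem norm_step (g : G) (s : G) (hs : s ∈ S) :
    (wordNorm (g * s) = wordNorm g + 1 ∨ wordNorm (g * s) + 1 = wordNorm g) ∧
    wordNorm (g * s) ≠ wordNorm g ∧
    (wordNorm (g * s) = wordNorm g + 1 ↔ [s⁻¹] ∉ Suf 1 g) := by
  have h₁ := wordNorm_mul_le g hs
  have h₂ := wordNorm_le_mul g hs
  have h₃ := wordNorm_mul_ne g hs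
  rw [inv_mem_Suf_one_iff g hs]
  omega

end PSL2Z
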